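/- Let $(X,d)$ be a metric space and $x_0\in X$. Suppose that for every $y\in X$ with $y\ne x_0$ there exist a real number $T_y \ge \max(1, d(x_0,y))$ and a continuous map $\gamma_y : [0,T_y]\to X$ such that $\gamma_y(d(x_0,y)) = y$ and $d(x_0,\gamma_y(t)) = t$ for all $t\in[0,T_y]$. Let $R>1$, $K\ge R$ and $0<k\le 1$ be real numbers. If the set $\{x\in X : 1\le d(x_0,x) < R\}$ is connected, then the set $\{x\in X : k\le d(x_0,x) < K\}$ is connected. -/

import Mathlib

/-- If every point admits a radial path through it along which the distance to the
center equals the parameter, then connectedness of the annulus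
`{1 ≤ d(x₀,·) < R}` implies connectedness of any larger annulus
`{k ≤ d(x₀,·) < K}` with `K ≥ R` and `0 < k ≤ 1`. -/
theorem stmt_7 {X : Type*} [MetricSpace X] (x₀ : X)
    (hrad : ∀ y : X, y ≠ x₀ → ∃ (T : ℝ) (γ : ℝ → X),
      max 1 (dist x₀ y) ≤ T ∧ ContinuousOn γ (Set.Icc 0 T) ∧
      γ (dist x₀ y) = y ∧ ∀ t ∈ Set.Icc (0 : ℝ) T, dist x₀ (γ t) = t)
    (R K k : ℝ) (hR : 1 < R) (hK : R ≤ K) (hk0 : 0 < k) (hk1 : k ≤ 1)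
    (hconn : IsConnected {x : X | 1 ≤ dist x₀ x ∧ dist x₀ x < R}) :
    IsConnected {x : X | k ≤ dist x₀ x ∧ dist x₀ x < K} := by
  obtain ⟨⟨p, hp⟩, hpre⟩ := hconn
  have hp' : 1 ≤ dist x₀ p ∧ dist x₀ p < R := hp
  refine ⟨⟨p, by constructor <;> linarith [hp'.1, hp'.2]⟩, ?_⟩
  refine isPreconnected_of_forall p ?_
  rintro y ⟨hy1, hy2⟩
  have hne : y ≠ x₀ := by
    rintro rfl
    rw [dist_self] at hy1
    linarith
  obtain ⟨T, γ, hT, hc, hγ, hd⟩ := hrad y hne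
  have hT1 : 1 ≤ T := le_trans (le_max_left _ _) hT
  have hT2 : dist x₀ y ≤ T := le_trans (le_max_right _ _) hT
  have hsub : Set.uIcc 1 (dist x₀ y) ⊆ Set.Icc 0 T :=
    Set.uIcc_subset_Icc ⟨zero_le_one, hT1⟩ ⟨dist_nonneg, hT2⟩
  have hsub2 : Set.uIcc 1 (dist x₀ y) ⊆ Set.Ico k K :=
    Set.OrdConnected.uIcc_subset Set.ordConnected_Ico ⟨hk1, by linarith⟩ ⟨hy1, hy2⟩
  have h1 : dist x₀ (γ 1) = 1 := hd 1 ⟨zero_le_one, hT1⟩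
  refine ⟨{x : X | 1 ≤ dist x₀ x ∧ dist x₀ x < R} ∪ γ '' Set.uIcc 1 (dist x₀ y),
    ?_, Or.inl hp, Or.inr ⟨_, Set.right_mem_uIcc, hγ⟩, ?_⟩
  · rintro z (⟨hz1, hz2⟩ | ⟨t, ht, rfl⟩)
    · exact ⟨by linarith, by linarith⟩
    · have := hsub2 ht
      change k ≤ dist x₀ (γ t) ∧ dist x₀ (γ t) < K
      rw [hd t (hsub ht)]
      exact this
  · refine IsPreconnected.union (γ 1) ?_ ⟨1, Set.left_mem_uIcc, rfl⟩ hpre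
      (isPreconnected_uIcc.image γ (hc.mono hsub))
    change 1 ≤ dist x₀ (γ 1) ∧ dist x₀ (γ 1) < R
    rw [h1]
    exact ⟨le_rfl, hR⟩
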